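/- Suppose τ admits ∂ₓτ at every point and satisfies the differential Fay identity. Let t : ℕ → ℂ be finitely supported, and let λ, μ be nonzero complex numbers with λ ≠ ±μ, τ(t) ≠ 0 and τ(t+2[λ⁻¹]) ≠ 0. Then ψ(t,−λ)·∂ₓ[ψ(·,μ)](t) − ψ(t,μ)·∂ₓ[ψ(·,−λ)](t) = −∂ₓ[ψ(·+2[λ⁻¹],μ)·ψ(·,−λ)](t), where ψ(t,μ) = exp(ξ(t,μ))·τ(t−2[μ⁻¹])/τ(t), ψ(t,−λ) = exp(−ξ(t,λ))·τ(t+2[λ⁻¹])/τ(t), ψ(t+2[λ⁻¹],μ) = exp(ξ(t,μ))·((λ+μ)/(λ−μ))·τ(t+2[λ⁻¹]−2[μ⁻¹])/τ(t+2[λ⁻¹]), and ∂ₓ is applied to each bracketed expression as a function of t via the first coordinate. (This is the x-derivative form of the B-type squared eigenfunction potential formula Ω(ψ_BA(t,μ), ψ_BA(t,−λ)) = −ψ_BA(t+2[λ⁻¹],μ)·ψ_BA(t,−λ), eqs. (4.3)/(4.10), since ∂ₓΩ(Φ₁,Φ₂) = Φ₂·∂ₓΦ₁ − Φ₁·∂ₓΦ₂.)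 -/

import Mathlib

open Complex

noncomputable section

/-- The shifted time sequence `t + 2[s]`, given by `(t + 2[s]) n = t n + 2 s^(2n+1)/(2n+1)`. -/
def shift (t : ℕ → ℂ) (s : ℂ) : ℕ → ℂ :=
  fun n => t n + 2 * s ^ (2 * n + 1) / ((2 * n + 1 : ℕ) : ℂ)

/-- `ξ(t,z) = Σ_n t_n z^(2n+1)` (a finite sum for finitely supported `t`). -/
def xi (t : ℕ → ℂ) (z : ℂ) : ℂ := ∑ᶠ n : ℕ, t n * z ^ (2 * n + 1)

/-- Derivative with respect to `x = t₁` (coordinate `0`). -/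
def dx (F : (ℕ → ℂ) → ℂ) (t : ℕ → ℂ) : ℂ :=
  deriv (fun y => F (Function.update t 0 y)) (t 0)

/-- The Fay identity of the BKP hierarchy. -/
def FayIdentity (τ : (ℕ → ℂ) → ℂ) : Prop :=
  ∀ (t : ℕ → ℂ) (s₀ s₁ s₂ s₃ : ℂ),
    s₁ + s₀ ≠ 0 → s₂ + s₀ ≠ 0 → s₃ + s₀ ≠ 0 →
    s₁ - s₂ ≠ 0 → s₁ - s₃ ≠ 0 → s₂ - s₃ ≠ 0 →
    (s₁ - s₀) * (s₁ + s₂) * (s₁ + s₃) / ((s₁ + s₀) * (s₁ - s₂) * (s₁ - s₃)) *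
        (τ (shift (shift t s₂) s₃) * τ (shift (shift t s₀) s₁))
      + (s₂ - s₀) * (s₂ + s₃) * (s₂ + s₁) / ((s₂ + s₀) * (s₂ - s₃) * (s₂ - s₁)) *
        (τ (shift (shift t s₃) s₁) * τ (shift (shift t s₀) s₂))
      + (s₃ - s₀) * (s₃ + s₁) * (s₃ + s₂) / ((s₃ + s₀) * (s₃ - s₁) * (s₃ - s₂)) *
        (τ (shift (shift t s₁) s₂) * τ (shift (shift t s₀) s₃))
      + (s₀ - s₁) * (s₀ - s₂) * (s₀ - s₃) / ((s₀ + s₁) * (s₀ + s₂) * (s₀ + s₃)) *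
        (τ (shift (shift (shift (shift t s₀) s₁) s₂) s₃) * τ t) = 0

/-- The differential Fay identity of the BKP hierarchy. -/
def DiffFay (τ : (ℕ → ℂ) → ℂ) : Prop :=
  ∀ (t : ℕ → ℂ) (s₁ s₂ : ℂ), s₁ ≠ 0 → s₂ ≠ 0 →
    (1 / s₂ ^ 2 - 1 / s₁ ^ 2) *
        (τ (shift t s₁) * τ (shift t s₂) - τ (shift (shift t s₁) s₂) * τ t)
      = (1 / s₂ + 1 / s₁) *
          (dx τ (shift t s₂) * τ (shift t s₁) - dx τ (shift t s₁) * τ (shift t s₂))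
        + (1 / s₂ - 1 / s₁) *
          (τ (shift (shift t s₁) s₂) * dx τ t - dx τ (shift (shift t s₁) s₂) * τ t)
theorem shift_update_zero (t : ℕ → ℂ) (y s : ℂ) :
    shift (Function.update t 0 y) s = Function.update (shift t s) 0 (y + 2 * s) := by
  funext n
  rcases n with _ | n <;> simp [shift]

theorem hasDerivAt_comp_shift {τ : (ℕ → ℂ) → ℂ} {t : ℕ → ℂ} {s τ' : ℂ}
    (h : HasDerivAt (fun y => τ (Function.update (shift t s) 0 y)) τ' (shift t s 0)) :
    HasDerivAt (fun y => τ (shift (Function.update t 0 y) s)) τ' (t 0) := by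
  simp only [shift_update_zero]
  refine HasDerivAt.comp_add_const (f := fun y => τ (Function.update (shift t s) 0 y)) _ _ ?_
  simpa [shift] using h

theorem xi_update_zero {t : ℕ → ℂ} (ht : (Function.support t).Finite) (y z : ℂ) :
    xi (Function.update t 0 y) z = xi t z + (y - t 0) * z := by
  have hsplit : ∀ n, Function.update t 0 y n * z ^ (2 * n + 1) =
      t n * z ^ (2 * n + 1) + Pi.single (M := fun _ => ℂ) 0 (y - t 0) n * z ^ (2 * n + 1) := by
    rintro (_ | n)
    · simp
      ring
    · simp
  have hsingle : ∀ n, n ≠ 0 →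
      Pi.single (M := fun _ => ℂ) 0 (y - t 0) n * z ^ (2 * n + 1) = 0 := by
    intro n hn
    simp [hn]
  unfold xi
  rw [finsum_congr hsplit, finsum_add_distrib, finsum_eq_single _ 0 hsingle]
  · simp
  · exact ht.subset fun n hn => left_ne_zero_of_mul hn
  · refine (Set.finite_singleton 0).subset fun n hn => ?_
    by_contra h
    exact hn (hsingle n h)

theorem hasDerivAt_xi {t : ℕ → ℂ} (ht : (Function.support t).Finite) (z : ℂ) :
    HasDerivAt (fun y => xi (Function.update t 0 y) z) z (t 0) := by
  simp only [xi_update_zero ht]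
  simpa using (((hasDerivAt_id (t 0)).sub_const (t 0)).mul_const z).const_add (xi t z)

/-- The x-derivative form of the BSEP formula
`Ω(ψ_BA(t,μ), ψ_BA(t,−λ)) = −ψ_BA(t+2[λ⁻¹],μ)·ψ_BA(t,−λ)` (eqs. (4.3)/(4.10)). -/
theorem bsep_x_derivative (τ : (ℕ → ℂ) → ℂ)
    (hdiff : ∀ t : ℕ → ℂ, DifferentiableAt ℂ (fun y => τ (Function.update t 0 y)) (t 0))
    (hdFay : DiffFay τ)
    (t : ℕ → ℂ) (hsupp : (Function.support t).Finite)
    (lam μ : ℂ) (hlam : lam ≠ 0) (hmu : μ ≠ 0)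
    (hlm : lam ≠ μ) (hlm' : lam ≠ -μ)
    (ht : τ t ≠ 0) (htl : τ (shift t lam⁻¹) ≠ 0) :
    (Complex.exp (-xi t lam) * τ (shift t lam⁻¹) / τ t) *
        dx (fun u => Complex.exp (xi u μ) * τ (shift u (-μ⁻¹)) / τ u) t
      - (Complex.exp (xi t μ) * τ (shift t (-μ⁻¹)) / τ t) *
          dx (fun u => Complex.exp (-xi u lam) * τ (shift u lam⁻¹) / τ u) t
      = - dx (fun u =>
            (Complex.exp (xi u μ) * ((lam + μ) / (lam - μ)) *
                τ (shift (shift u lam⁻¹) (-μ⁻¹)) / τ (shift u lam⁻¹)) *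
            (Complex.exp (-xi u lam) * τ (shift u lam⁻¹) / τ u)) t := by
  have hτ (u : ℕ → ℂ) :
      HasDerivAt (fun y => τ (Function.update u 0 y)) (dx τ u) (u 0) := (hdiff u).hasDerivAt
  have hT := hτ t
  have hA := hasDerivAt_comp_shift (hτ (shift t lam⁻¹))
  have hB := hasDerivAt_comp_shift (hτ (shift t (-μ⁻¹)))
  have hC := hasDerivAt_comp_shift (τ := fun u => τ (shift u (-μ⁻¹)))
    (hasDerivAt_comp_shift (hτ (shift (shift t lam⁻¹) (-μ⁻¹))))
  have hEμ := (hasDerivAt_xi hsupp μ).cexp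
  have hEl := (hasDerivAt_xi hsupp lam).fun_neg.cexp
  have hψμ := ((hEμ.fun_mul hB).fun_div hT (by simpa using ht)).deriv
  have hψl := ((hEl.fun_mul hA).fun_div hT (by simpa using ht)).deriv
  have hprod := ((((hEμ.mul_const ((lam + μ) / (lam - μ))).fun_mul hC).fun_div hA
    (by simpa using htl)).fun_mul ((hEl.fun_mul hA).fun_div hT (by simpa using ht))).deriv
  have hFay := hdFay t lam⁻¹ (-μ⁻¹) (inv_ne_zero hlam) (neg_ne_zero.mpr (inv_ne_zero hmu))
  simp only [Function.update_eq_self] at hψμ hψl hprod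
  rw [dx, dx, dx, hψμ, hψl, hprod]
  have hsub : lam - μ ≠ 0 := sub_ne_zero.mpr hlm
  have h₁ : 1 / lam⁻¹ = lam := by simp
  have h₂ : 1 / -μ⁻¹ = -μ := by simp
  have h₃ : 1 / lam⁻¹ ^ 2 = lam ^ 2 := by simp
  have h₄ : 1 / (-μ⁻¹) ^ 2 = μ ^ 2 := by simp
  rw [h₁, h₂, h₃, h₄] at hFay
  generalize τ (shift (shift t lam⁻¹) (-μ⁻¹)) = C at *
  generalize dx τ (shift (shift t lam⁻¹) (-μ⁻¹)) = C' at *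
  generalize τ (shift t lam⁻¹) = A at *
  generalize dx τ (shift t lam⁻¹) = A' at *
  generalize τ (shift t (-μ⁻¹)) = B at *
  generalize dx τ (shift t (-μ⁻¹)) = B' at *
  generalize τ t = T at *
  generalize dx τ t = T' at *
  generalize cexp (xi t μ) = E at *
  generalize cexp (-xi t lam) = F at *
  field_simp
  linear_combination (-(F * A * E * T)) * hFay
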